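/- Let u, v, w, z : ℝ × ℝ → ℝ be smooth functions of (x,t) solving the generalized Riemann equation at N=4, i.e. u_t = 2u·u_x − 2v, v_t = 2u·v_x − 2w, w_t = 2u·w_x − 2z, z_t = 2u·z_x, with z_x nowhere zero. Define α₁ = (w_x² − 2v_x·z_x)·z_x^{−2}, β₁ = (v_x² − 2u_x·w_x + 2z_x)·z_x^{−2}, γ₁ = (w_x³ − 3z_x·v_x·w_x + 3z_x²·u_x)·z_x^{−3}, δ₁ = w_x·z_x^{−1}, and recursively α_{k+1} = z_x^{−1}·∂_x α_k, β_{k+1} = z_x^{−1}·∂_x β_k, γ_{k+1} = z_x^{−1}·∂_x γ_k, δ_{k+1} = z_x^{−1}·∂_x δ_k for k ≥ 1. Then at every point: ∂_t α_k = 2u·∂_x α_k, ∂_t β_k = 2u·∂_x β_k, ∂_t γ_k = 2u·∂_x γ_k for all k ≥ 1, ∂_t δ₁ = 2u·∂_x δ₁ − 2, and ∂_t δ_k = 2u·∂_x δ_k for all k ≥ 2. -/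

import Mathlib

/-- Partial derivative with respect to the first variable `x`. -/
noncomputable def pdx (f : ℝ × ℝ → ℝ) (p : ℝ × ℝ) : ℝ := deriv (fun x => f (x, p.2)) p.1

/-- Partial derivative with respect to the second variable `t`. -/
noncomputable def pdt (f : ℝ × ℝ → ℝ) (p : ℝ × ℝ) : ℝ := deriv (fun t => f (p.1, t)) p.2

theorem pdx_eq_fderiv {f : ℝ × ℝ → ℝ} {p : ℝ × ℝ} (hf : DifferentiableAt ℝ f p) :
    pdx f p = fderiv ℝ f p (1, 0) := by
  have h : HasDerivAt (fun x : ℝ => (x, p.2)) ((1 : ℝ), (0 : ℝ)) p.1 :=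
    (hasDerivAt_id p.1).prodMk (hasDerivAt_const p.1 p.2)
  exact (HasFDerivAt.comp_hasDerivAt (l := f) p.1 hf.hasFDerivAt h).deriv

theorem pdt_eq_fderiv {f : ℝ × ℝ → ℝ} {p : ℝ × ℝ} (hf : DifferentiableAt ℝ f p) :
    pdt f p = fderiv ℝ f p (0, 1) := by
  have h : HasDerivAt (fun t : ℝ => (p.1, t)) ((0 : ℝ), (1 : ℝ)) p.2 :=
    (hasDerivAt_const p.2 p.1).prodMk (hasDerivAt_id p.2)
  exact (HasFDerivAt.comp_hasDerivAt (l := f) p.2 hf.hasFDerivAt h).deriv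

theorem differentiable_of_contDiff_top {f : ℝ × ℝ → ℝ} (hf : ContDiff ℝ (⊤ : ℕ∞) f) :
    Differentiable ℝ f :=
  hf.differentiable (by simp)

theorem contDiff_fderiv_apply {f : ℝ × ℝ → ℝ} (hf : ContDiff ℝ (⊤ : ℕ∞) f) (e : ℝ × ℝ) :
    ContDiff ℝ (⊤ : ℕ∞) (fun p => fderiv ℝ f p e) :=
  (hf.fderiv_right (by simp)).clm_apply contDiff_const

theorem pdx_eq_fderiv_fun {f : ℝ × ℝ → ℝ} (hf : Differentiable ℝ f) :
    pdx f = fun p => fderiv ℝ f p (1, 0) :=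
  funext fun p => pdx_eq_fderiv (hf p)

theorem pdt_eq_fderiv_fun {f : ℝ × ℝ → ℝ} (hf : Differentiable ℝ f) :
    pdt f = fun p => fderiv ℝ f p (0, 1) :=
  funext fun p => pdt_eq_fderiv (hf p)

theorem contDiff_pdx {f : ℝ × ℝ → ℝ} (hf : ContDiff ℝ (⊤ : ℕ∞) f) :
    ContDiff ℝ (⊤ : ℕ∞) (pdx f) := by
  rw [pdx_eq_fderiv_fun (differentiable_of_contDiff_top hf)]
  exact contDiff_fderiv_apply hf _

theorem contDiff_pdt {f : ℝ × ℝ → ℝ} (hf : ContDiff ℝ (⊤ : ℕ∞) f) :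
    ContDiff ℝ (⊤ : ℕ∞) (pdt f) := by
  rw [pdt_eq_fderiv_fun (differentiable_of_contDiff_top hf)]
  exact contDiff_fderiv_apply hf _

theorem pdt_pdx_comm {f : ℝ × ℝ → ℝ} (hf : ContDiff ℝ (⊤ : ℕ∞) f) (p : ℝ × ℝ) :
    pdt (pdx f) p = pdx (pdt f) p := by
  have hd := differentiable_of_contDiff_top hf
  have hf' : DifferentiableAt ℝ (fderiv ℝ f) p :=
    (hf.fderiv_right (m := 1) (WithTop.coe_le_coe.2 le_top)).differentiable (by simp) p
  have hsymm : IsSymmSndFDerivAt ℝ f p :=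
    hf.contDiffAt.isSymmSndFDerivAt (by
      simp only [minSmoothness_of_isRCLikeNormedField]
      exact WithTop.coe_le_coe.2 le_top)
  rw [pdt_eq_fderiv (differentiable_of_contDiff_top (contDiff_pdx hf) p),
    pdx_eq_fderiv (differentiable_of_contDiff_top (contDiff_pdt hf) p),
    pdx_eq_fderiv_fun hd, pdt_eq_fderiv_fun hd,
    fderiv_clm_apply hf' (differentiableAt_const _),
    fderiv_clm_apply hf' (differentiableAt_const _)]
  simpa using hsymm (0, 1) (1, 0)

/-- The derivative of `f` along the flow of the operator `∂ₜ - 2 u ∂ₓ`. -/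
noncomputable def advection (u f : ℝ × ℝ → ℝ) (p : ℝ × ℝ) : ℝ :=
  pdt f p - 2 * u p * pdx f p

theorem hasLineDerivAt_advection (u : ℝ × ℝ → ℝ) {f : ℝ × ℝ → ℝ} {p : ℝ × ℝ}
    (hf : DifferentiableAt ℝ f p) :
    HasLineDerivAt ℝ f (advection u f p) p (-2 * u p, 1) := by
  have h := hf.hasFDerivAt.hasLineDerivAt (-2 * u p, 1)
  have he : ((-2 * u p, 1) : ℝ × ℝ) = (-2 * u p) • ((1 : ℝ), (0 : ℝ)) + ((0 : ℝ), (1 : ℝ)) := by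
    simp
  have hval : fderiv ℝ f p (-2 * u p, 1) = advection u f p := by
    rw [he, map_add, map_smul, ← pdx_eq_fderiv hf, ← pdt_eq_fderiv hf, advection, smul_eq_mul]
    ring
  rwa [hval] at h

theorem advection_eq_of_hasLineDerivAt {u f : ℝ × ℝ → ℝ} {p : ℝ × ℝ} {c : ℝ}
    (hf : DifferentiableAt ℝ f p) (h : HasLineDerivAt ℝ f c p (-2 * u p, 1)) :
    advection u f p = c :=
  (hasLineDerivAt_advection u hf).unique h

theorem advection_mul_inv {u f g : ℝ × ℝ → ℝ} {p : ℝ × ℝ}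
    (hf : DifferentiableAt ℝ f p) (hg : DifferentiableAt ℝ g p) (h0 : g p ≠ 0) :
    advection u (fun q => f q * (g q)⁻¹) p =
      (advection u f p * g p - f p * advection u g p) / g p ^ 2 := by
  refine advection_eq_of_hasLineDerivAt (hf.mul (hg.inv h0)) ?_
  have hF := hasLineDerivAt_advection u hf
  have hG := hasLineDerivAt_advection u hg
  unfold HasLineDerivAt at hF hG ⊢
  have h := hF.fun_div hG (by simpa using h0)
  simpa [div_eq_mul_inv] using h

theorem advection_pdx {u f : ℝ × ℝ → ℝ} (hu : ContDiff ℝ (⊤ : ℕ∞) u)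
    (hf : ContDiff ℝ (⊤ : ℕ∞) f) (p : ℝ × ℝ) :
    advection u (pdx f) p = pdx (advection u f) p + 2 * pdx u p * pdx f p := by
  have hslice : ∀ {g : ℝ × ℝ → ℝ}, ContDiff ℝ (⊤ : ℕ∞) g →
      HasDerivAt (fun x => g (x, p.2)) (pdx g p) p.1 := fun {g} hg =>
    DifferentiableAt.hasDerivAt (((differentiable_of_contDiff_top hg).comp
      (differentiable_id.prodMk (differentiable_const p.2))) p.1)
  have h := ((hslice (contDiff_pdt hf)).fun_sub
    (((hslice hu).const_mul 2).fun_mul (hslice (contDiff_pdx hf)))).deriv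
  have h' : pdx (advection u f) p = _ := h
  rw [h', advection, pdt_pdx_comm hf]
  ring

theorem advection_inv_mul_pdx {u z f : ℝ × ℝ → ℝ} {c : ℝ} (hu : ContDiff ℝ (⊤ : ℕ∞) u)
    (hz : ContDiff ℝ (⊤ : ℕ∞) z) (hf : ContDiff ℝ (⊤ : ℕ∞) f)
    (hz0 : ∀ p, advection u z p = 0) (hzx : ∀ p, pdx z p ≠ 0)
    (hfc : ∀ p, advection u f p = c) (p : ℝ × ℝ) :
    advection u (fun q => (pdx z q)⁻¹ * pdx f q) p = 0 := by
  have hconst : ∀ {g : ℝ × ℝ → ℝ} {a : ℝ}, ContDiff ℝ (⊤ : ℕ∞) g →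
      (∀ q, advection u g q = a) → advection u (pdx g) p = 2 * pdx u p * pdx g p := by
    intro g a hg ha
    rw [advection_pdx hu hg, funext ha]
    simp [pdx]
  simp_rw [mul_comm (pdx z _)⁻¹]
  rw [advection_mul_inv (differentiable_of_contDiff_top (contDiff_pdx hf) p)
    (differentiable_of_contDiff_top (contDiff_pdx hz) p) (hzx p), hconst hz hz0, hconst hf hfc]
  ring

theorem contDiff_inv_mul_pdx {z f : ℝ × ℝ → ℝ}
    (hz : ContDiff ℝ (⊤ : ℕ∞) z) (hf : ContDiff ℝ (⊤ : ℕ∞) f) (hzx : ∀ p, pdx z p ≠ 0) :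
    ContDiff ℝ (⊤ : ℕ∞) (fun q => (pdx z q)⁻¹ * pdx f q) :=
  ((contDiff_pdx hz).inv hzx).mul (contDiff_pdx hf)

theorem advection_eq_zero_of_recurrence {u z : ℝ × ℝ → ℝ} {F : ℕ → ℝ × ℝ → ℝ} {n : ℕ}
    (hu : ContDiff ℝ (⊤ : ℕ∞) u) (hz : ContDiff ℝ (⊤ : ℕ∞) z)
    (hz0 : ∀ p, advection u z p = 0) (hzx : ∀ p, pdx z p ≠ 0)
    (hF : ContDiff ℝ (⊤ : ℕ∞) (F n)) (hF0 : ∀ p, advection u (F n) p = 0)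
    (hrec : ∀ k, n ≤ k → ∀ p, F (k + 1) p = (pdx z p)⁻¹ * pdx (F k) p) (k : ℕ) (hk : n ≤ k) :
    ∀ p, advection u (F k) p = 0 := by
  suffices ContDiff ℝ (⊤ : ℕ∞) (F k) ∧ ∀ p, advection u (F k) p = 0 from this.2
  induction k, hk using Nat.le_induction with
  | base => exact ⟨hF, hF0⟩
  | succ k hk ih =>
    rw [funext (hrec k hk)]
    exact ⟨contDiff_inv_mul_pdx hz ih.1 hzx, advection_inv_mul_pdx hu hz ih.1 hz0 hzx ih.2⟩

theorem riemannN4_evolution_of_new_variables (u v w z : ℝ × ℝ → ℝ)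
    (hu : ContDiff ℝ (⊤ : ℕ∞) u) (hv : ContDiff ℝ (⊤ : ℕ∞) v) (hw : ContDiff ℝ (⊤ : ℕ∞) w)
    (hz : ContDiff ℝ (⊤ : ℕ∞) z)
    (hequ : ∀ p : ℝ × ℝ, pdt u p = 2 * u p * pdx u p - 2 * v p)
    (heqv : ∀ p : ℝ × ℝ, pdt v p = 2 * u p * pdx v p - 2 * w p)
    (heqw : ∀ p : ℝ × ℝ, pdt w p = 2 * u p * pdx w p - 2 * z p)
    (heqz : ∀ p : ℝ × ℝ, pdt z p = 2 * u p * pdx z p)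
    (hzx : ∀ p : ℝ × ℝ, pdx z p ≠ 0)
    (α β γ δ : ℕ → ℝ × ℝ → ℝ)
    (hα1 : ∀ p : ℝ × ℝ,
      α 1 p = ((pdx w p) ^ 2 - 2 * pdx v p * pdx z p) * ((pdx z p) ^ 2)⁻¹)
    (hβ1 : ∀ p : ℝ × ℝ,
      β 1 p = ((pdx v p) ^ 2 - 2 * pdx u p * pdx w p + 2 * pdx z p) * ((pdx z p) ^ 2)⁻¹)
    (hγ1 : ∀ p : ℝ × ℝ,
      γ 1 p = ((pdx w p) ^ 3 - 3 * pdx z p * pdx v p * pdx w p + 3 * (pdx z p) ^ 2 * pdx u p)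
        * ((pdx z p) ^ 3)⁻¹)
    (hδ1 : ∀ p : ℝ × ℝ, δ 1 p = pdx w p * (pdx z p)⁻¹)
    (hαrec : ∀ k, 1 ≤ k → ∀ p : ℝ × ℝ, α (k + 1) p = (pdx z p)⁻¹ * pdx (α k) p)
    (hβrec : ∀ k, 1 ≤ k → ∀ p : ℝ × ℝ, β (k + 1) p = (pdx z p)⁻¹ * pdx (β k) p)
    (hγrec : ∀ k, 1 ≤ k → ∀ p : ℝ × ℝ, γ (k + 1) p = (pdx z p)⁻¹ * pdx (γ k) p)
    (hδrec : ∀ k, 1 ≤ k → ∀ p : ℝ × ℝ, δ (k + 1) p = (pdx z p)⁻¹ * pdx (δ k) p) :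
    (∀ k, 1 ≤ k → ∀ p : ℝ × ℝ, pdt (α k) p = 2 * u p * pdx (α k) p) ∧
    (∀ k, 1 ≤ k → ∀ p : ℝ × ℝ, pdt (β k) p = 2 * u p * pdx (β k) p) ∧
    (∀ k, 1 ≤ k → ∀ p : ℝ × ℝ, pdt (γ k) p = 2 * u p * pdx (γ k) p) ∧
    (∀ p : ℝ × ℝ, pdt (δ 1) p = 2 * u p * pdx (δ 1) p - 2) ∧
    (∀ k, 2 ≤ k → ∀ p : ℝ × ℝ, pdt (δ k) p = 2 * u p * pdx (δ k) p) := by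
  have hD : ∀ {f g : ℝ × ℝ → ℝ}, ContDiff ℝ (⊤ : ℕ∞) f → ContDiff ℝ (⊤ : ℕ∞) g →
      (∀ p, pdt f p = 2 * u p * pdx f p - 2 * g p) → ∀ p,
      advection u (pdx f) p = 2 * pdx u p * pdx f p - 2 * pdx g p := by
    intro f g hf hg h p
    have hfg : advection u f = fun q => -2 * g q := by
      funext q
      rw [advection, h q]
      ring
    have hpdx : pdx (fun q => -2 * g q) p = -2 * pdx g p := by
      simp [pdx]
    rw [advection_pdx hu hf, hfg, hpdx]
    ring
  have hz0 : ∀ p, advection u z p = 0 := fun p => by rw [advection, heqz p, sub_self]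
  have hDz : ∀ p, advection u (pdx z) p = 2 * pdx u p * pdx z p := by
    intro p
    rw [advection_pdx hu hz, funext hz0]
    simp [pdx]
  have hDu := hD hu hv hequ
  have hDv := hD hv hw heqv
  have hDw := hD hw hz heqw
  have cu := contDiff_pdx hu
  have cv := contDiff_pdx hv
  have cw := contDiff_pdx hw
  have cz := contDiff_pdx hz
  have lu := fun p => hasLineDerivAt_advection u (differentiable_of_contDiff_top cu p)
  have lv := fun p => hasLineDerivAt_advection u (differentiable_of_contDiff_top cv p)
  have lw := fun p => hasLineDerivAt_advection u (differentiable_of_contDiff_top cw p)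
  have lz := fun p => hasLineDerivAt_advection u (differentiable_of_contDiff_top cz p)
  simp only [hDu, hDv, hDw, hDz, HasLineDerivAt] at lu lv lw lz
  have cα : ContDiff ℝ (⊤ : ℕ∞) (α 1) := by
    rw [funext hα1]
    exact ((cw.pow 2).sub ((contDiff_const.mul cv).mul cz)).mul
      ((cz.pow 2).inv fun p => pow_ne_zero 2 (hzx p))
  have cβ : ContDiff ℝ (⊤ : ℕ∞) (β 1) := by
    rw [funext hβ1]
    exact (((cv.pow 2).sub ((contDiff_const.mul cu).mul cw)).add (contDiff_const.mul cz)).mul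
      ((cz.pow 2).inv fun p => pow_ne_zero 2 (hzx p))
  have cγ : ContDiff ℝ (⊤ : ℕ∞) (γ 1) := by
    rw [funext hγ1]
    exact (((cw.pow 3).sub (((contDiff_const.mul cz).mul cv).mul cw)).add
      ((contDiff_const.mul (cz.pow 2)).mul cu)).mul
      ((cz.pow 3).inv fun p => pow_ne_zero 3 (hzx p))
  have cδ : ContDiff ℝ (⊤ : ℕ∞) (δ 1) := by
    rw [funext hδ1]
    exact cw.mul (cz.inv hzx)
  have aα : ∀ p, advection u (α 1) p = 0 := by
    intro p
    refine advection_eq_of_hasLineDerivAt (differentiable_of_contDiff_top cα p) ?_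
    rw [funext hα1]
    have h := (((lw p).fun_pow 2).fun_sub (((lv p).const_mul 2).fun_mul (lz p))).fun_mul
      (((lz p).fun_pow 2).fun_inv (by simpa using hzx p))
    refine h.congr_deriv ?_
    have := hzx p
    simp only [zero_smul, add_zero]
    field_simp
    ring
  have aβ : ∀ p, advection u (β 1) p = 0 := by
    intro p
    refine advection_eq_of_hasLineDerivAt (differentiable_of_contDiff_top cβ p) ?_
    rw [funext hβ1]
    have h := ((((lv p).fun_pow 2).fun_sub (((lu p).const_mul 2).fun_mul (lw p))).fun_add
      ((lz p).const_mul 2)).fun_mul (((lz p).fun_pow 2).fun_inv (by simpa using hzx p))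
    refine h.congr_deriv ?_
    have := hzx p
    simp only [zero_smul, add_zero]
    field_simp
    ring
  have aγ : ∀ p, advection u (γ 1) p = 0 := by
    intro p
    refine advection_eq_of_hasLineDerivAt (differentiable_of_contDiff_top cγ p) ?_
    rw [funext hγ1]
    have h := ((((lw p).fun_pow 3).fun_sub
      ((((lz p).const_mul 3).fun_mul (lv p)).fun_mul (lw p))).fun_add
      ((((lz p).fun_pow 2).const_mul 3).fun_mul (lu p))).fun_mul
      (((lz p).fun_pow 3).fun_inv (by simpa using hzx p))
    refine h.congr_deriv ?_
    have := hzx p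
    simp only [zero_smul, add_zero]
    field_simp
    ring
  have aδ : ∀ p, advection u (δ 1) p = -2 := by
    intro p
    have := hzx p
    rw [funext hδ1, advection_mul_inv (differentiable_of_contDiff_top cw p)
      (differentiable_of_contDiff_top cz p) (hzx p), hDw, hDz]
    field_simp
    ring
  have cδ2 : ContDiff ℝ (⊤ : ℕ∞) (δ 2) := by
    rw [funext (hδrec 1 le_rfl)]
    exact contDiff_inv_mul_pdx hz cδ hzx
  have aδ2 : ∀ p, advection u (δ 2) p = 0 := by
    rw [funext (hδrec 1 le_rfl)]
    exact advection_inv_mul_pdx hu hz cδ hz0 hzx aδ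
  refine ⟨fun k hk p => ?_, fun k hk p => ?_, fun k hk p => ?_, fun p => ?_, fun k hk p => ?_⟩
  · exact sub_eq_zero.1 (advection_eq_zero_of_recurrence hu hz hz0 hzx cα aα hαrec k hk p)
  · exact sub_eq_zero.1 (advection_eq_zero_of_recurrence hu hz hz0 hzx cβ aβ hβrec k hk p)
  · exact sub_eq_zero.1 (advection_eq_zero_of_recurrence hu hz hz0 hzx cγ aγ hγrec k hk p)
  · have h := aδ p
    rw [advection] at h
    linarith
  · exact sub_eq_zero.1 (advection_eq_zero_of_recurrence hu hz hz0 hzx cδ2 aδ2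
      (fun k hk => hδrec k (one_le_two.trans hk)) k hk p)
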